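/- Fix C > 300. Let D > 1 be a squarefree fundamental discriminant and let ψ be the associated primitive quadratic character modulo D. Let q be a prime with D^{300} ≤ q ≤ D^{C}, set X := D^{20}, and for each Dirichlet character χ modulo q define the mollifier M(χ) := Σ_{n ≤ X, D ∤ n} (μ ∗ μψ)(n)·χ(n)/√n. Then for any δ ∈ (0, 1], the number of non-principal Dirichlet characters χ modulo q with |L(1/2, χψ)·M(χ)| ≥ δ^{-1/2}·(log q)^{9/2} is O(δ·φ(q)), where the implied constant depends only on C. -/

import Mathlib

open Complex DirichletCharacter Finset

/-- `e(x) = exp(2πix)`. -/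
noncomputable def eFun (x : ℝ) : ℂ := Complex.exp (2 * Real.pi * Complex.I * x)

/-- The root number `ε(χ) = τ(χ)/N^{1/2}` of a Dirichlet character mod `N`
(the terms with `(a, N) > 1` vanish since `χ a = 0` there). -/
noncomputable def epsChar {N : ℕ} [NeZero N] (χ : DirichletCharacter ℂ N) : ℂ :=
  (Real.sqrt N : ℂ)⁻¹ * ∑ a : ZMod N, χ a * eFun ((a.val : ℝ) / N)

/-- The product of a character mod `q` and a character mod `D`, as a character mod `q * D`. -/
noncomputable def prodChar {q D : ℕ} (χ : DirichletCharacter ℂ q)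
    (ψ : DirichletCharacter ℂ D) : DirichletCharacter ℂ (q * D) :=
  changeLevel (dvd_mul_right q D) χ * changeLevel (dvd_mul_left D q) ψ


/-- The Dirichlet convolution `(μ ∗ μψ)(n) = Σ_{ab = n} μ(a)·μ(b)ψ(b)`. -/
noncomputable def mollifierCoeff {D : ℕ} (ψ : DirichletCharacter ℂ D) (n : ℕ) : ℂ :=
  ∑ d ∈ n.divisors, ((ArithmeticFunction.moebius d : ℤ) : ℂ) *
    ((ArithmeticFunction.moebius (n / d) : ℤ) : ℂ) * ψ ((n / d : ℕ) : ZMod D)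

/-- The mollifier `M(χ) = Σ_{n ≤ X, D ∤ n} (μ ∗ μψ)(n) χ(n) / √n`. -/
noncomputable def mollifier {q D : ℕ} (ψ : DirichletCharacter ℂ D) (X : ℕ)
    (χ : DirichletCharacter ℂ q) : ℂ :=
  ∑ n ∈ Finset.Icc 1 X, if ¬ D ∣ n then
    mollifierCoeff ψ n * χ ((n : ℕ) : ZMod q) / (Real.sqrt n : ℂ) else 0

lemma hasSum_int_of_residues {N : ℕ} [NeZero N] (Φ : ZMod N → ℂ) (f : ℤ → ℂ) (K : ZMod N → ℂ)
    (h : ∀ j : ZMod N, HasSum (fun m : ℤ ↦ f (j.val + N * m)) (K j)) :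
    HasSum (fun n : ℤ ↦ Φ n * f n) (∑ j, Φ j * K j) := by
  have hN : (N : ℤ) ≠ 0 := by exact_mod_cast NeZero.ne N
  have key (j : ZMod N) : HasSum (fun n : ℤ ↦ if (n : ZMod N) = j then f n else 0) (K j) := by
    have hinj : Function.Injective (fun m : ℤ ↦ (j.val : ℤ) + N * m) := fun a b hab ↦
      mul_left_cancel₀ hN (add_left_cancel hab)
    rw [← hinj.hasSum_iff]
    · refine (h j).congr_fun fun m ↦ ?_
      simp
    · intro n hn
      rw [if_neg]
      rintro rfl
      refine hn ⟨n / N, ?_⟩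
      simp only [ZMod.val_intCast]
      exact Int.emod_add_mul_ediv n N
  refine (hasSum_sum fun j (_ : j ∈ univ) ↦ (key j).mul_left (Φ j)).congr_fun fun n ↦ ?_
  simp

/-- The sum over positive integers underlying the theta series of a Dirichlet character. -/
noncomputable def thetaTerm {N : ℕ} (ν : ℕ) (χ : DirichletCharacter ℂ N) (x : ℝ) (n : ℕ) : ℂ :=
  χ n * (n : ℂ) ^ ν * Real.exp (-Real.pi * n ^ 2 * (x / N))

lemma hasSum_thetaTerm_of_int {N : ℕ} [NeZero N] {ν : ℕ} {χ : DirichletCharacter ℂ N}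
    (hχ0 : χ 0 = 0)
    (hpar : χ (-1) = (-1) ^ ν) {x : ℝ} {a : ℂ}
    (h : HasSum (fun n : ℤ ↦ χ n * ((n : ℂ) ^ ν * Real.exp (-Real.pi * n ^ 2 * (x / N)))) (2 * a)) :
    HasSum (thetaTerm ν χ x) a := by
  have h2 := h.nat_add_neg
  simp only [Int.cast_zero, hχ0, zero_mul, add_zero] at h2
  have h3 := h2.mul_left (1 / 2)
  rw [show (1 / 2 : ℂ) * (2 * a) = a by ring] at h3
  refine h3.congr_fun fun n ↦ ?_
  have : χ (((-(n : ℤ) : ℤ)) : ZMod N) = (-1) ^ ν * χ n := by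
    rw [← hpar, ← map_mul]; simp
  rw [this, thetaTerm]
  push_cast
  rw [show (-(n : ℂ)) ^ ν = (-1) ^ ν * (n : ℂ) ^ ν by rw [← mul_pow]; simp]
  have h1 : ((-1 : ℂ) ^ ν) * (-1) ^ ν = 1 := by rw [← mul_pow]; simp
  rw [neg_sq]
  linear_combination (-(1 / 2 : ℂ) * χ n * (n : ℂ) ^ ν * cexp (-↑Real.pi * ↑n ^ 2 * (↑x / ↑N))) * h1

lemma hasSum_thetaTerm_kernel {N : ℕ} [NeZero N] {ν : ℕ} {χ : DirichletCharacter ℂ N}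
    (hχ0 : χ 0 = 0) (hpar : χ (-1) = (-1) ^ ν) {K : UnitAddCircle → ℝ → ℝ}
    (hK : ∀ (a : ℝ) {t : ℝ}, 0 < t →
      HasSum (fun n : ℤ ↦ (n + a) ^ ν * Real.exp (-Real.pi * (n + a) ^ 2 * t)) (K a t))
    {x : ℝ} (hx : 0 < x) :
    HasSum (thetaTerm ν χ x) ((N : ℂ) ^ ν / 2 * ∑ j, χ j * K (ZMod.toAddCircle j) (N * x)) := by
  have hN : (0 : ℝ) < N := by exact_mod_cast NeZero.pos N
  have hN' : (N : ℂ) ≠ 0 := by exact_mod_cast NeZero.ne N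
  apply hasSum_thetaTerm_of_int hχ0 hpar
  have := (hasSum_int_of_residues χ (fun n : ℤ ↦
    (((n : ℝ) / N) ^ ν * Real.exp (-Real.pi * (n / N) ^ 2 * (N * x)) : ℝ))
    (fun j ↦ K (ZMod.toAddCircle j) (N * x)) (fun j ↦ ?_)).mul_left ((N : ℂ) ^ ν)
  · rw [show (2 : ℂ) * ((N : ℂ) ^ ν / 2 * ∑ j, χ j * K (ZMod.toAddCircle j) (N * x)) =
      (N : ℂ) ^ ν * ∑ j, χ j * K (ZMod.toAddCircle j) (N * x) by ring]
    refine this.congr_fun fun n ↦ ?_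
    have e : -Real.pi * ((n : ℝ) / N) ^ 2 * (N * x) = -Real.pi * n ^ 2 * (x / N) := by
      field_simp
    rw [e, Complex.ofReal_mul]
    push_cast
    rw [div_pow]
    field_simp
  · rw [hasSum_ofReal, ZMod.toAddCircle_apply]
    refine (hK _ (mul_pos hN hx)).congr_fun fun m ↦ ?_
    have : (((j.val : ℤ) + N * m : ℤ) : ℝ) / N = m + (j.val : ℝ) / N := by
      push_cast; field_simp; ring
    rw [this]

lemma hasSum_thetaTerm_dualKernel {N : ℕ} [NeZero N] {ν : ℕ} {χ : DirichletCharacter ℂ N}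
    (hprim : χ.IsPrimitive) (hχ0 : χ 0 = 0) (hpar : χ (-1) = (-1) ^ ν) {C : UnitAddCircle → ℝ → ℝ}
    (hC : ∀ (a : ℝ) {t : ℝ}, 0 < t → HasSum (fun n : ℤ ↦ (-I) ^ ν * (n : ℂ) ^ ν *
      cexp (2 * Real.pi * I * a * n) * Real.exp (-Real.pi * n ^ 2 * t)) (C a t : ℂ))
    (hg : gaussSum χ ZMod.stdAddChar ≠ 0)
    {x : ℝ} (hx : 0 < x) :
    HasSum (thetaTerm ν χ⁻¹ x) (((-I) ^ ν * gaussSum χ ZMod.stdAddChar * 2)⁻¹ *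
      ∑ j, χ j * C (ZMod.toAddCircle j) (x / N)) := by
  have hN : (0 : ℝ) < N := by exact_mod_cast NeZero.pos N
  have hN' : (N : ℂ) ≠ 0 := by exact_mod_cast NeZero.ne N
  have hI : (-I) ^ ν ≠ 0 := by simp
  apply hasSum_thetaTerm_of_int
  · rw [MulChar.inv_apply_eq_inv, hχ0]; simp
  · rw [MulChar.inv_apply_eq_inv, hpar, Ring.inverse_eq_inv', ← inv_pow]; norm_num
  have h1 := (hasSum_sum fun j (_ : j ∈ univ) ↦
    (hC ((j.val : ℝ) / N) (div_pos hx hN)).mul_left (χ j)).mul_left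
      (((-I) ^ ν * gaussSum χ ZMod.stdAddChar)⁻¹)
  simp only [← ZMod.toAddCircle_apply] at h1
  rw [mul_inv_rev _ (2 : ℂ), mul_assoc (2 : ℂ)⁻¹, mul_inv_cancel_left₀ two_ne_zero]
  refine h1.congr_fun fun n ↦ ?_
  have hs : gaussSum χ (ZMod.stdAddChar.mulShift (n : ZMod N)) =
      ∑ j, χ j * cexp (2 * Real.pi * I * ((j.val : ℝ) / N : ℝ) * n) := by
    refine Finset.sum_congr rfl fun j _ ↦ ?_
    congr 1
    rw [AddChar.mulShift_apply]
    conv_lhs => rw [← ZMod.natCast_zmod_val j]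
    rw [show (n : ZMod N) * (j.val : ZMod N) = ((n * j.val : ℤ) : ZMod N) by push_cast; rfl,
      ZMod.stdAddChar_coe]
    congr 1
    push_cast
    ring
  rw [gaussSum_mulShift_of_isPrimitive _ hprim] at hs
  have : ∑ j, χ j * ((-I) ^ ν * (n : ℂ) ^ ν * cexp (2 * Real.pi * I * ((j.val : ℝ) / N : ℝ) * n)
      * Real.exp (-Real.pi * n ^ 2 * (x / N))) = (χ⁻¹ n * gaussSum χ ZMod.stdAddChar) *
      ((-I) ^ ν * (n : ℂ) ^ ν * Real.exp (-Real.pi * n ^ 2 * (x / N))) := by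
    rw [hs, Finset.sum_mul]
    refine Finset.sum_congr rfl fun j _ ↦ by ring
  rw [this]
  field_simp

open ZMod in
lemma norm_gaussSum_of_isPrimitive {N : ℕ} [NeZero N] {χ : DirichletCharacter ℂ N}
    (hχ : χ.IsPrimitive) : ‖gaussSum χ ZMod.stdAddChar‖ ^ 2 = N := by
  have h := congrFun (ZMod.dft_dft (fun j ↦ χ j)) (-1)
  rw [ZMod.dft_apply] at h
  simp only [hχ.fourierTransform_eq_inv_mul_gaussSum, neg_neg, map_one, smul_eq_mul, mul_one,
    mul_neg] at h
  have hconj : (starRingEnd ℂ) (gaussSum χ ZMod.stdAddChar) =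
      ∑ j : ZMod N, ZMod.stdAddChar j * χ⁻¹ (-j) := by
    rw [gaussSum, map_sum, ← Equiv.sum_comp (Equiv.neg (ZMod N))]
    refine Finset.sum_congr rfl fun j _ ↦ ?_
    simp only [Equiv.neg_apply, map_mul, starRingEnd_apply, MulChar.star_apply']
    rw [← starRingEnd_apply, ← AddChar.map_neg_eq_conj, neg_neg, mul_comm]
  rw [← Complex.ofReal_inj, Complex.ofReal_pow, ← Complex.mul_conj', hconj, Finset.mul_sum]
  simp only [ofReal_natCast, ← h]
  refine Finset.sum_congr rfl fun j _ ↦ by ring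

open MeasureTheory in
/-- The upper incomplete Gamma integral `∫_1^∞ x^(σ-1) e^(-cx) dx`. -/
noncomputable def gammaTail (σ c : ℝ) : ℝ := ∫ x in Set.Ioi (1 : ℝ), x ^ (σ - 1) * Real.exp (-(c * x))

open MeasureTheory in
lemma integrableOn_gammaTail {σ c : ℝ} (hσ : 0 < σ) (hc : 0 < c) :
    IntegrableOn (fun x : ℝ ↦ x ^ (σ - 1) * Real.exp (-(c * x))) (Set.Ioi 0) := by
  have := integrableOn_rpow_mul_exp_neg_mul_rpow (s := σ - 1) (p := 1) (b := c) (by linarith) one_pos hc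
  simpa [Real.rpow_one, neg_mul] using this

open MeasureTheory in
lemma gammaTail_nonneg (σ c : ℝ) : 0 ≤ gammaTail σ c :=
  setIntegral_nonneg measurableSet_Ioi fun x (hx : 1 < x) ↦ by positivity

open MeasureTheory in
lemma gammaTail_le {σ c : ℝ} (hσ : 0 < σ) (hc : 0 < c) :
    gammaTail σ c ≤ Real.exp (-(c / 2)) * ((1 / (c / 2)) ^ σ * Real.Gamma σ) := by
  have hc2 : 0 < c / 2 := by positivity
  rw [← Real.integral_rpow_mul_exp_neg_mul_Ioi hσ hc2, ← integral_const_mul]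
  have hint : IntegrableOn (fun x : ℝ ↦ Real.exp (-(c / 2)) *
      (x ^ (σ - 1) * Real.exp (-(c / 2 * x)))) (Set.Ioi 0) :=
    (integrableOn_gammaTail hσ hc2).const_mul (Real.exp (-(c / 2)))
  refine le_trans (setIntegral_mono_on ((integrableOn_gammaTail hσ hc).mono_set
    (Set.Ioi_subset_Ioi zero_le_one)) (hint.mono_set (Set.Ioi_subset_Ioi zero_le_one)) measurableSet_Ioi
    fun x (hx : 1 < x) ↦ ?_) (setIntegral_mono_set hint ?_ (Set.Ioi_subset_Ioi zero_le_one).eventuallyLE)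
  · rw [mul_left_comm, ← Real.exp_add]
    gcongr
    nlinarith
  · refine (ae_restrict_iff' measurableSet_Ioi).mpr (.of_forall fun x (hx : 0 < x) ↦ ?_)
    simp only [Pi.zero_apply]
    positivity

lemma summable_pow_mul_gammaTail {N : ℕ} [NeZero N] {σ : ℝ} (hσ : 0 < σ) (ν : ℕ) :
    Summable fun n : ℕ ↦ ((n + 1 : ℕ) : ℝ) ^ ν * gammaTail σ (Real.pi * ((n + 1 : ℕ) : ℝ) ^ 2 / N) := by
  have hN : (0 : ℝ) < N := by exact_mod_cast NeZero.pos N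
  set r : ℝ := Real.pi / N / 2 with hr
  have hr0 : 0 < r := by positivity
  have h1 := (summable_nat_add_iff 1).mpr (Real.summable_pow_mul_exp_neg_nat_mul ν hr0)
  refine (h1.mul_right ((1 / r) ^ σ * Real.Gamma σ)).of_nonneg_of_le
    (fun n ↦ mul_nonneg (by positivity) (gammaTail_nonneg _ _)) fun n ↦ ?_
  set m : ℝ := ((n + 1 : ℕ) : ℝ) with hm
  have hm1 : 1 ≤ m := by rw [hm]; exact_mod_cast Nat.le_add_left 1 n
  have hg : 0 < Real.Gamma σ := Real.Gamma_pos_of_pos hσ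
  rw [mul_assoc]
  refine mul_le_mul_of_nonneg_left ((gammaTail_le hσ (by positivity)).trans ?_) (by positivity)
  have e : Real.pi * m ^ 2 / N / 2 = r * m ^ 2 := by rw [hr]; ring
  rw [e]
  have h2 : r ≤ r * m ^ 2 := le_mul_of_one_le_right hr0.le (one_le_pow₀ hm1)
  gcongr
  nlinarith

open MeasureTheory in
lemma integral_tsum_thetaTerm {N : ℕ} [NeZero N] {ν : ℕ} {σ : ℝ} (hσ : 0 < σ)
    {χ : DirichletCharacter ℂ N} (hχ0 : χ 0 = 0) :
    ∫ x in Set.Ioi (1 : ℝ), (x : ℂ) ^ ((σ : ℂ) - 1) * ∑' n, thetaTerm ν χ x n =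
      ∑' n : ℕ, χ n * (n : ℂ) ^ ν * gammaTail σ (Real.pi * n ^ 2 / N) := by
  have hN : (0 : ℝ) < N := by exact_mod_cast NeZero.pos N
  have hcp {x : ℝ} (hx : 1 < x) : (x : ℂ) ^ ((σ : ℂ) - 1) = ((x ^ (σ - 1) : ℝ) : ℂ) := by
    rw [Complex.ofReal_cpow (by linarith)]; push_cast; rfl
  have hF (n : ℕ) : Set.EqOn (fun x : ℝ ↦ (x : ℂ) ^ ((σ : ℂ) - 1) * thetaTerm ν χ x n)
      (fun x ↦ (χ n * (n : ℂ) ^ ν) *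
        ((x ^ (σ - 1) * Real.exp (-(Real.pi * n ^ 2 / N * x)) : ℝ) : ℂ)) (Set.Ioi 1) := by
    intro x hx
    simp only [hcp hx, thetaTerm]
    rw [show -Real.pi * (n : ℝ) ^ 2 * (x / N) = -(Real.pi * n ^ 2 / N * x) by ring]
    push_cast
    ring
  have hzero (x : ℝ) : thetaTerm ν χ x 0 = 0 := by simp [thetaTerm, hχ0]
  have hI (n : ℕ) : ∫ x in Set.Ioi (1 : ℝ), (x : ℂ) ^ ((σ : ℂ) - 1) * thetaTerm ν χ x n =
      χ n * (n : ℂ) ^ ν * gammaTail σ (Real.pi * n ^ 2 / N) := by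
    rw [setIntegral_congr_fun measurableSet_Ioi (hF n), integral_const_mul, gammaTail, integral_complex_ofReal]
  have hint (n : ℕ) : Integrable (fun x : ℝ ↦ (x : ℂ) ^ ((σ : ℂ) - 1) * thetaTerm ν χ x n)
      (volume.restrict (Set.Ioi 1)) := by
    rcases eq_or_ne n 0 with rfl | hn
    · simp [hzero]
    refine IntegrableOn.congr_fun ?_ (hF n).symm measurableSet_Ioi
    exact (((integrableOn_gammaTail hσ (c := Real.pi * n ^ 2 / N) (by positivity)).mono_set
      (Set.Ioi_subset_Ioi zero_le_one)).ofReal).const_mul _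
  simp only [← tsum_mul_left]
  rw [← tsum_congr hI, ← integral_tsum_of_summable_integral_norm hint]
  rw [← summable_nat_add_iff 1]
  refine (summable_pow_mul_gammaTail (N := N) hσ ν).of_nonneg_of_le
    (fun n ↦ integral_nonneg fun x ↦ norm_nonneg _) fun n ↦ ?_
  rw [gammaTail, ← integral_const_mul]
  have hc : 0 < Real.pi * ((n + 1 : ℕ) : ℝ) ^ 2 / N := by positivity
  refine setIntegral_mono_on (hint (n + 1)).norm (((integrableOn_gammaTail hσ hc).mono_set
      (Set.Ioi_subset_Ioi zero_le_one)).const_mul _) measurableSet_Ioi fun x (hx : 1 < x) ↦ ?_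
  have hFx := hF (n + 1) hx
  simp only at hFx
  rw [hFx, norm_mul, norm_mul, norm_pow, Complex.norm_natCast, Complex.norm_real,
    Real.norm_of_nonneg (by positivity)]
  have := χ.norm_le_one ((n + 1 : ℕ) : ZMod N)
  gcongr
  exact mul_le_of_le_one_left (by positivity) this

open MeasureTheory in
lemma mellin_eq_integral_Ioi_one {F : ℝ → ℂ} {s : ℂ} (h : MellinConvergent F s) :
    mellin F s = (∫ x in Set.Ioi (1 : ℝ), (x : ℂ) ^ (s - 1) * F x) +
      ∫ x in Set.Ioi (1 : ℝ), (x : ℂ) ^ (-s - 1) * F x⁻¹ := by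
  have h' : IntegrableOn (fun x : ℝ ↦ (x : ℂ) ^ (s - 1) • F x) (Set.Ioi 0) := h
  have e1 : mellin F s = (∫ x in Set.Ioc (0 : ℝ) 1, (x : ℂ) ^ (s - 1) * F x) +
      ∫ x in Set.Ioi (1 : ℝ), (x : ℂ) ^ (s - 1) * F x := by
    rw [mellin, ← Set.Ioc_union_Ioi_eq_Ioi zero_le_one, setIntegral_union Set.Ioc_disjoint_Ioi_same
      measurableSet_Ioi (h'.mono_set Set.Ioc_subset_Ioi_self)
      (h'.mono_set (Set.Ioi_subset_Ioi zero_le_one))]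
    simp only [smul_eq_mul]
  have e2 : (∫ x in Set.Ioc (0 : ℝ) 1, (x : ℂ) ^ (s - 1) * F x) =
      mellin ((Set.Ioc 0 1).indicator F) s := by
    have : (fun x : ℝ ↦ (x : ℂ) ^ (s - 1) • (Set.Ioc 0 1).indicator F x) =
        (Set.Ioc 0 1).indicator (fun x : ℝ ↦ (x : ℂ) ^ (s - 1) * F x) := by
      ext x
      by_cases hx : x ∈ Set.Ioc (0 : ℝ) 1 <;> simp [hx]
    rw [mellin, this, setIntegral_indicator measurableSet_Ioc]
    congr 2
    ext x
    simp +contextual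
  have e3 := mellin_comp_inv ((Set.Ioc 0 1).indicator F) (-s)
  rw [neg_neg] at e3
  rw [e1, e2, ← e3, add_comm, mellin, ← integral_Ici_eq_integral_Ioi (x := (1 : ℝ))
    (f := fun x : ℝ ↦ (x : ℂ) ^ (-s - 1) * F x⁻¹)]
  congr 1
  have : Set.EqOn (fun x : ℝ ↦ (x : ℂ) ^ (-s - 1) • (Set.Ioc 0 1).indicator F x⁻¹)
      ((Set.Ici 1).indicator (fun x : ℝ ↦ (x : ℂ) ^ (-s - 1) * F x⁻¹)) (Set.Ioi 0) := by
    intro x (hx : 0 < x)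
    by_cases h1 : 1 ≤ x
    · have : x⁻¹ ∈ Set.Ioc (0 : ℝ) 1 := ⟨by positivity, inv_le_one_of_one_le₀ h1⟩
      simp [this, h1]
    · have : x⁻¹ ∉ Set.Ioc (0 : ℝ) 1 := fun h ↦ h1 ((inv_le_one₀ hx).mp h.2)
      simp only [Set.indicator_of_notMem this, smul_zero]
      rw [Set.indicator_of_notMem]
      simpa using h1
  rw [setIntegral_congr_fun measurableSet_Ioi this, setIntegral_indicator measurableSet_Ici]
  congr 2
  ext x
  simp only [Set.mem_inter_iff, Set.mem_Ioi, Set.mem_Ici, and_iff_right_iff_imp]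
  intro h; linarith

/-- The weight attached to the `n`-th coefficient in the symmetric approximate functional
equation at the central point, for modulus `N` and gamma factor with parameter `σ`. -/
noncomputable def afeWeight (σ : ℝ) (N n : ℕ) : ℝ :=
  (Real.pi * n ^ 2 / N) ^ σ * gammaTail σ (Real.pi * n ^ 2 / N) / Real.Gamma σ

lemma afeWeight_nonneg {σ : ℝ} (hσ : 0 < σ) (N n : ℕ) : 0 ≤ afeWeight σ N n :=
  div_nonneg (mul_nonneg (by positivity) (gammaTail_nonneg _ _)) (Real.Gamma_pos_of_pos hσ).le

lemma afeWeight_le {σ : ℝ} (hσ : 0 < σ) (hσ1 : σ ≤ 1) (N : ℕ) [NeZero N] (n : ℕ) :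
    afeWeight σ N n ≤ 2 * Real.exp (-(Real.pi * n ^ 2 / N / 2)) := by
  have hN : (0 : ℝ) < N := by exact_mod_cast NeZero.pos N
  rcases eq_or_ne n 0 with rfl | hn
  · simp [afeWeight, Real.zero_rpow hσ.ne']
  set c : ℝ := Real.pi * n ^ 2 / N with hc
  have hc0 : 0 < c := by positivity
  have hg := Real.Gamma_pos_of_pos hσ
  rw [afeWeight, ← hc, div_le_iff₀ hg]
  calc c ^ σ * gammaTail σ c ≤ c ^ σ * (Real.exp (-(c / 2)) * ((1 / (c / 2)) ^ σ * Real.Gamma σ)) := by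
        gcongr; exact gammaTail_le hσ hc0
    _ = 2 ^ σ * Real.exp (-(c / 2)) * Real.Gamma σ := by
        rw [show 1 / (c / 2) = 2 / c by field_simp, Real.div_rpow zero_le_two hc0.le]
        field_simp
    _ ≤ 2 * Real.exp (-(c / 2)) * Real.Gamma σ := by
        gcongr
        calc (2 : ℝ) ^ σ ≤ 2 ^ (1 : ℝ) := Real.rpow_le_rpow_of_exponent_le one_le_two hσ1
          _ = 2 := Real.rpow_one 2

lemma afeWeight_div_sqrt {σ : ℝ} {ν : ℕ} (hν : 2 * σ = 1 / 2 + ν) (hσ : 0 < σ) (N n : ℕ) [NeZero N]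
    (hn : n ≠ 0) :
    afeWeight σ N n / Real.sqrt n = (Real.pi ^ σ / (N : ℝ) ^ σ / Real.Gamma σ) *
      ((n : ℝ) ^ ν * gammaTail σ (Real.pi * n ^ 2 / N)) := by
  have hN : (0 : ℝ) < N := by exact_mod_cast NeZero.pos N
  have hn0 : (0 : ℝ) < n := by exact_mod_cast Nat.pos_of_ne_zero hn
  have hg := Real.Gamma_pos_of_pos hσ
  have e : ((n : ℝ) ^ 2) ^ σ = Real.sqrt n * (n : ℝ) ^ ν := by
    rw [← Real.rpow_natCast, ← Real.rpow_mul hn0.le, Nat.cast_ofNat, hν, Real.rpow_add hn0,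
      Real.rpow_natCast, Real.sqrt_eq_rpow]
  have hs : 0 < Real.sqrt n := Real.sqrt_pos.mpr hn0
  rw [afeWeight, Real.div_rpow (by positivity) hN.le, Real.mul_rpow Real.pi_pos.le (by positivity), e]
  field_simp

lemma tsum_inv_eq_conj {N : ℕ} (χ : DirichletCharacter ℂ N) (b : ℕ → ℝ) :
    ∑' n : ℕ, χ⁻¹ n * (b n : ℂ) = (starRingEnd ℂ) (∑' n : ℕ, χ n * (b n : ℂ)) := by
  rw [Complex.conj_tsum]
  refine tsum_congr fun n ↦ ?_
  rw [map_mul, Complex.conj_ofReal, starRingEnd_apply, MulChar.star_apply']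

open MeasureTheory in
lemma norm_mellin_kernel_le {N : ℕ} [NeZero N] {ν : ℕ} {σ : ℝ} (hσ : 0 < σ)
    (hν : 2 * σ = 1 / 2 + ν) {χ : DirichletCharacter ℂ N} (hprim : χ.IsPrimitive)
    (hχ0 : χ 0 = 0) (hpar : χ (-1) = (-1) ^ ν) {K C : UnitAddCircle → ℝ → ℝ}
    (hK : ∀ (a : ℝ) {t : ℝ}, 0 < t →
      HasSum (fun n : ℤ ↦ (n + a) ^ ν * Real.exp (-Real.pi * (n + a) ^ 2 * t)) (K a t))
    (hC : ∀ (a : ℝ) {t : ℝ}, 0 < t → HasSum (fun n : ℤ ↦ (-I) ^ ν * (n : ℂ) ^ ν *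
      cexp (2 * Real.pi * I * a * n) * Real.exp (-Real.pi * n ^ 2 * t)) (C a t : ℂ))
    (hFE : ∀ a x, K a x = 1 / x ^ (2 * σ) * C a (1 / x))
    (hconv : MellinConvergent (fun x ↦ ∑ j, χ j * K (ZMod.toAddCircle j) x) σ) :
    ‖mellin (fun x ↦ ∑ j, χ j * (K (ZMod.toAddCircle j) x : ℂ)) σ‖ ≤ (N : ℝ) ^ σ * (4 / (N : ℝ) ^ ν *
      ‖∑' n : ℕ, χ n * ((n : ℝ) ^ ν * gammaTail σ (Real.pi * n ^ 2 / N) : ℝ)‖) := by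
  have hN : (0 : ℝ) < N := by exact_mod_cast NeZero.pos N
  have hN' : (N : ℂ) ≠ 0 := by exact_mod_cast NeZero.ne N
  set G : ℝ → ℂ := fun x ↦ ∑ j, χ j * (K (ZMod.toAddCircle j) x : ℂ) with hG
  set τ := gaussSum χ ZMod.stdAddChar with hτ
  have hτn : ‖τ‖ ^ 2 = N := norm_gaussSum_of_isPrimitive hprim
  have hτ0 : τ ≠ 0 := by
    intro h; rw [h] at hτn; simp at hτn; exact hN.ne hτn
  have hχi0 : χ⁻¹ 0 = 0 := by rw [MulChar.inv_apply_eq_inv, hχ0]; simp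
  set S := ∑' n : ℕ, χ n * ((n : ℝ) ^ ν * gammaTail σ (Real.pi * n ^ 2 / N) : ℝ) with hS
  have hI : (-I) ^ ν ≠ 0 := by simp
  have hconv' : MellinConvergent (fun x ↦ G (N * x)) σ :=
    (MellinConvergent.comp_mul_left hN).mpr hconv
  have hscale := mellin_comp_mul_left G σ hN
  have hval : mellin (fun x ↦ G (N * x)) σ = 2 / (N : ℂ) ^ ν * S +
      2 * (-I) ^ ν * τ / ((N : ℝ) ^ (2 * σ) : ℝ) * (starRingEnd ℂ) S := by
    rw [mellin_eq_integral_Ioi_one hconv']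
    congr 1
    · have h1 : Set.EqOn (fun x : ℝ ↦ (x : ℂ) ^ ((σ : ℂ) - 1) * G (N * x))
          (fun x ↦ 2 / (N : ℂ) ^ ν * ((x : ℂ) ^ ((σ : ℂ) - 1) * ∑' n, thetaTerm ν χ x n))
          (Set.Ioi 1) := by
        intro x (hx : 1 < x)
        simp only
        rw [(hasSum_thetaTerm_kernel hχ0 hpar hK (by linarith : 0 < x)).tsum_eq]
        simp only [hG]
        field_simp
      rw [setIntegral_congr_fun measurableSet_Ioi h1, integral_const_mul,
        integral_tsum_thetaTerm hσ hχ0, hS]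
      congr 2
      ext n
      push_cast
      ring
    · have h1 : Set.EqOn (fun x : ℝ ↦ (x : ℂ) ^ (-(σ : ℂ) - 1) * G (N * x⁻¹))
          (fun x ↦ 2 * (-I) ^ ν * τ / ((N : ℝ) ^ (2 * σ) : ℝ) *
            ((x : ℂ) ^ ((σ : ℂ) - 1) * ∑' n, thetaTerm ν χ⁻¹ x n))
          (Set.Ioi 1) := by
        intro x (hx : 1 < x)
        have hx0 : 0 < x := by linarith
        simp only
        rw [(hasSum_thetaTerm_dualKernel hprim hχ0 hpar hC hτ0 hx0).tsum_eq]
        have h2 : G (N * x⁻¹) = ((x ^ (2 * σ) / (N : ℝ) ^ (2 * σ) : ℝ) : ℂ) *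
            ∑ j, χ j * C (ZMod.toAddCircle j) (x / N) := by
          simp only [hG, Finset.mul_sum]
          refine Finset.sum_congr rfl fun j _ ↦ ?_
          rw [hFE, show 1 / (N * x⁻¹) = x / N by field_simp, ← div_eq_mul_inv,
            Real.div_rpow hN.le hx0.le, one_div_div]
          push_cast
          ring
        have h3 : (x : ℂ) ^ ((σ : ℂ) - 1) = (x : ℂ) ^ (-(σ : ℂ) - 1) * (x ^ (2 * σ) : ℝ) := by
          have : (x : ℂ) ≠ 0 := by exact_mod_cast hx0.ne'
          rw [Complex.ofReal_cpow hx0.le, ← Complex.cpow_add _ _ this]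
          congr 1
          push_cast
          ring
        rw [h2, h3]
        push_cast
        rw [← hτ]
        have : ((N : ℂ) ^ (2 * σ : ℂ)) ≠ 0 := by
          rw [Complex.cpow_ne_zero_iff]; exact Or.inl hN'
        field_simp
      rw [setIntegral_congr_fun measurableSet_Ioi h1, integral_const_mul,
        integral_tsum_thetaTerm hσ hχi0, hS, ← tsum_inv_eq_conj]
      congr 2
      ext n
      push_cast
      ring
  have hGF : mellin G σ = (N : ℂ) ^ (σ : ℂ) * mellin (fun x ↦ G (N * x)) σ := by
    rw [hscale, smul_eq_mul, ← mul_assoc, Complex.ofReal_natCast, ← Complex.cpow_add _ _ hN']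
    simp
  rw [hGF, norm_mul, hval]
  have hNσ : ‖(N : ℂ) ^ (σ : ℂ)‖ = (N : ℝ) ^ σ := by
    rw [← Complex.ofReal_natCast, Complex.norm_cpow_eq_rpow_re_of_pos hN, Complex.ofReal_re]
  rw [hNσ]
  gcongr
  refine (norm_add_le _ _).trans ?_
  have hτs : ‖τ‖ = (N : ℝ) ^ (1 / 2 : ℝ) := by
    rw [← hτn, ← Real.sqrt_eq_rpow, Real.sqrt_sq (norm_nonneg _)]
  have hNpos := Real.rpow_pos_of_pos hN (1 / 2)
  rw [norm_mul, norm_mul, norm_div, norm_div, norm_mul, norm_mul, norm_pow, norm_pow, norm_neg,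
    Complex.norm_I, one_pow, Complex.norm_natCast, Complex.norm_real, RCLike.norm_conj, hτs, hν,
    Real.rpow_add hN, Real.rpow_natCast, Complex.norm_two, Real.norm_of_nonneg (by positivity)]
  apply le_of_eq
  field_simp
  ring

lemma norm_LFunction_half_le_of_kernel {N : ℕ} [NeZero N] {ν : ℕ} {σ : ℝ} (hσ : 0 < σ)
    (hν : 2 * σ = 1 / 2 + ν) {χ : DirichletCharacter ℂ N} (hprim : χ.IsPrimitive)
    (hχ0 : χ 0 = 0) (hpar : χ (-1) = (-1) ^ ν) {K C : UnitAddCircle → ℝ → ℝ}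
    (hK : ∀ (a : ℝ) {t : ℝ}, 0 < t →
      HasSum (fun n : ℤ ↦ (n + a) ^ ν * Real.exp (-Real.pi * (n + a) ^ 2 * t)) (K a t))
    (hC : ∀ (a : ℝ) {t : ℝ}, 0 < t → HasSum (fun n : ℤ ↦ (-I) ^ ν * (n : ℂ) ^ ν *
      cexp (2 * Real.pi * I * a * n) * Real.exp (-Real.pi * n ^ 2 * t)) (C a t : ℂ))
    (hFE : ∀ a x, K a x = 1 / x ^ (2 * σ) * C a (1 / x))
    (hconv : MellinConvergent (fun x ↦ ∑ j, χ j * K (ZMod.toAddCircle j) x) σ)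
    (hL : LFunction χ (1 / 2) = (N : ℂ) ^ (-(1 / 2) : ℂ) *
      (mellin (fun x ↦ ∑ j, χ j * (K (ZMod.toAddCircle j) x : ℂ)) σ / 2) / Gammaℝ (2 * σ)) :
    ‖LFunction χ (1 / 2)‖ ≤ 2 * ‖∑' n : ℕ, χ n * (afeWeight σ N n / Real.sqrt n : ℝ)‖ := by
  have hN : (0 : ℝ) < N := by exact_mod_cast NeZero.pos N
  have hg := Real.Gamma_pos_of_pos hσ
  have hmain := norm_mellin_kernel_le hσ hν hprim hχ0 hpar hK hC hFE hconv
  have hsum : ∑' n : ℕ, χ n * (afeWeight σ N n / Real.sqrt n : ℝ) =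
      ((Real.pi ^ σ / (N : ℝ) ^ σ / Real.Gamma σ : ℝ) : ℂ) *
        ∑' n : ℕ, χ n * ((n : ℝ) ^ ν * gammaTail σ (Real.pi * n ^ 2 / N) : ℝ) := by
    rw [← tsum_mul_left]
    refine tsum_congr fun n ↦ ?_
    rcases eq_or_ne n 0 with rfl | hn
    · simp [hχ0]
    · rw [afeWeight_div_sqrt hν hσ N n hn, Complex.ofReal_mul]
      ring
  have hGam : ‖Gammaℝ (2 * σ)‖ = Real.pi ^ (-σ) * Real.Gamma σ := by
    rw [Gammaℝ_def, norm_mul, show (2 * (σ : ℂ) / 2) = (σ : ℂ) by ring,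
      show (-(2 * (σ : ℂ)) / 2) = ((-σ : ℝ) : ℂ) by push_cast; ring, Complex.Gamma_ofReal,
      Complex.norm_real, Real.norm_of_nonneg hg.le,
      Complex.norm_cpow_eq_rpow_re_of_pos Real.pi_pos, Complex.ofReal_re]
  have hNh : ‖(N : ℂ) ^ (-(1 / 2) : ℂ)‖ = (N : ℝ) ^ (-(1 / 2) : ℝ) := by
    rw [← Complex.ofReal_natCast, Complex.norm_cpow_eq_rpow_re_of_pos hN]
    norm_num
  rw [hsum, hL, norm_div, norm_mul, norm_div, hGam, hNh, norm_mul, Complex.norm_real,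
    Real.norm_of_nonneg (by positivity), Complex.norm_two]
  set T := ‖∑' n : ℕ, χ n * ((n : ℝ) ^ ν * gammaTail σ (Real.pi * n ^ 2 / N) : ℝ)‖
  calc _ ≤ (N : ℝ) ^ (-(1 / 2) : ℝ) * ((N : ℝ) ^ σ * (4 / (N : ℝ) ^ ν * T) / 2) /
        (Real.pi ^ (-σ) * Real.Gamma σ) := by gcongr
    _ = _ := by
      have e : (N : ℝ) ^ σ * (N : ℝ) ^ σ = (N : ℝ) ^ (1 / 2 : ℝ) * (N : ℝ) ^ ν := by
        rw [← Real.rpow_add hN, ← two_mul, hν, Real.rpow_add hN, Real.rpow_natCast]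
      rw [Real.rpow_neg hN.le, Real.rpow_neg Real.pi_pos.le]
      field_simp
      rw [sq, e]
      ring

open MeasureTheory in
lemma HasMellin.finsetSum_const_mul {ι : Type*} {t : Finset ι} {f : ι → ℝ → ℂ} {s : ℂ} {m c : ι → ℂ}
    (h : ∀ i ∈ t, HasMellin (f i) s (m i)) :
    HasMellin (fun x ↦ ∑ i ∈ t, c i * f i x) s (∑ i ∈ t, c i * m i) := by
  have hint (i) (hi : i ∈ t) : IntegrableOn (fun x : ℝ ↦ c i * ((x : ℂ) ^ (s - 1) • f i x))
      (Set.Ioi 0) := (h i hi).1.const_mul (c i)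
  have e : (fun x : ℝ ↦ (x : ℂ) ^ (s - 1) • ∑ i ∈ t, c i * f i x) =
      fun x : ℝ ↦ ∑ i ∈ t, c i * ((x : ℂ) ^ (s - 1) • f i x) := by
    ext x
    simp only [smul_eq_mul, Finset.mul_sum]
    exact Finset.sum_congr rfl fun i _ ↦ by ring
  refine ⟨?_, ?_⟩
  · rw [MellinConvergent, e]
    exact integrable_finsetSum t hint
  · rw [mellin, e, integral_finsetSum t hint]
    refine Finset.sum_congr rfl fun i hi ↦ ?_
    rw [integral_const_mul, ← (h i hi).2, mellin]

open MeasureTheory in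
lemma HasMellin.congr_of_ne_one {f g : ℝ → ℂ} {s m : ℂ} (hf : HasMellin f s m)
    (h : ∀ x, 0 < x → x ≠ 1 → f x = g x) : HasMellin g s m := by
  have hae : (fun x : ℝ ↦ (x : ℂ) ^ (s - 1) • f x) =ᵐ[volume.restrict (Set.Ioi 0)]
      fun x : ℝ ↦ (x : ℂ) ^ (s - 1) • g x := by
    rw [Filter.EventuallyEq, ae_restrict_iff' measurableSet_Ioi]
    filter_upwards [compl_mem_ae_iff.mpr (measure_singleton (1 : ℝ))] with x hx hx0
    rw [h x hx0 hx]
  refine ⟨hf.1.congr hae, ?_⟩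
  rw [mellin, ← integral_congr_ae hae]
  exact hf.2

lemma norm_LFunction_half_le_of_even {N : ℕ} [NeZero N] {χ : DirichletCharacter ℂ N}
    (hprim : χ.IsPrimitive) (hχ0 : χ 0 = 0) (hχ : χ ≠ 1) (heven : χ.Even) :
    ‖LFunction χ (1 / 2)‖ ≤
      2 * ‖∑' n : ℕ, χ n * (afeWeight (1 / 4) N n / Real.sqrt n : ℝ)‖ := by
  have hsum : ∑ j, χ j = 0 := MulChar.sum_eq_zero_of_ne_one hχ
  set P := fun j : ZMod N ↦ HurwitzZeta.hurwitzEvenFEPair (ZMod.toAddCircle j)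
  have hstrong : HasMellin (fun x ↦ ∑ j, χ j * (P j).f_modif x) ((1 / 4 : ℝ) : ℂ)
      (∑ j, χ j * (P j).Λ₀ ((1 / 4 : ℝ) : ℂ)) :=
    HasMellin.finsetSum_const_mul fun j _ ↦
      ⟨((P j).isStrongFEPair_toStrongFEPair.hasMellin _).1, rfl⟩
  have hmel : HasMellin (fun x ↦ ∑ j, χ j *
      (HurwitzZeta.evenKernel (ZMod.toAddCircle j) x : ℂ)) ((1 / 4 : ℝ) : ℂ)
      (∑ j, χ j * (P j).Λ₀ ((1 / 4 : ℝ) : ℂ)) := by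
    refine hstrong.congr_of_ne_one fun x hx hx1 ↦ ?_
    rcases lt_or_gt_of_ne hx1 with h | h
    · have (j : ZMod N) : χ j * (P j).f_modif x = χ j *
          (HurwitzZeta.evenKernel (ZMod.toAddCircle j) x : ℂ) - χ j * (x ^ (-(1 / 2) : ℝ) : ℝ) := by
        simp [P, WeakFEPair.f_modif, HurwitzZeta.hurwitzEvenFEPair, h.not_gt, hx, h, mul_sub]
      simp_rw [this]
      rw [Finset.sum_sub_distrib, ← Finset.sum_mul, hsum, zero_mul, sub_zero]
    · refine Finset.sum_congr rfl fun j _ ↦ ?_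
      rcases eq_or_ne j 0 with rfl | hj
      · simp [hχ0]
      · simp [P, WeakFEPair.f_modif, HurwitzZeta.hurwitzEvenFEPair, h.not_gt, hx, h,
          hj]
  refine norm_LFunction_half_le_of_kernel (ν := 0) (σ := 1 / 4) (by norm_num) (by norm_num) hprim
    hχ0 (by rw [pow_zero]; exact heven) (K := HurwitzZeta.evenKernel) (C := HurwitzZeta.cosKernel) ?_ ?_ ?_
    hmel.1 ?_
  · intro a t ht
    simpa using HurwitzZeta.hasSum_int_evenKernel a ht
  · intro a t ht
    simpa using HurwitzZeta.hasSum_int_cosKernel a ht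
  · intro a x
    rw [HurwitzZeta.evenKernel_functional_equation]
    norm_num
  · have hev : (χ : ZMod N → ℂ).Even := heven.to_fun
    have hΛ : ∑ j, χ j * HurwitzZeta.completedHurwitzZetaEven (ZMod.toAddCircle j) (1 / 2) =
        (∑ j, χ j * (P j).Λ₀ ((1 / 4 : ℝ) : ℂ)) / 2 := by
      have (j : ZMod N) : χ j * HurwitzZeta.completedHurwitzZetaEven (ZMod.toAddCircle j) (1 / 2) =
          χ j * (P j).Λ₀ ((1 / 4 : ℝ) : ℂ) / 2 - χ j * 2 := by
        rw [HurwitzZeta.completedHurwitzZetaEven_eq, HurwitzZeta.completedHurwitzZetaEven₀]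
        rcases eq_or_ne j 0 with rfl | hj
        · simp [hχ0]
        · simp only [ZMod.toAddCircle_eq_zero.not.mpr hj, if_false]
          push_cast
          norm_num
          ring
      simp_rw [this]
      rw [Finset.sum_sub_distrib, ← Finset.sum_mul, hsum, zero_mul, sub_zero, Finset.sum_div]
    rw [LFunction, ZMod.LFunction_eq_completed_div_gammaFactor_even hev _ (.inr hχ0),
      ZMod.completedLFunction_def_even hev, hΛ, hmel.2]
    congr 2
    push_cast
    norm_num

lemma norm_LFunction_half_le_of_odd {N : ℕ} [NeZero N] {χ : DirichletCharacter ℂ N}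
    (hprim : χ.IsPrimitive) (hχ0 : χ 0 = 0) (hodd : χ.Odd) :
    ‖LFunction χ (1 / 2)‖ ≤
      2 * ‖∑' n : ℕ, χ n * (afeWeight (3 / 4) N n / Real.sqrt n : ℝ)‖ := by
  set P := fun j : ZMod N ↦ HurwitzZeta.hurwitzOddFEPair (ZMod.toAddCircle j)
  have hmel : HasMellin (fun x ↦ ∑ j, χ j *
      (HurwitzZeta.oddKernel (ZMod.toAddCircle j) x : ℂ)) ((3 / 4 : ℝ) : ℂ)
      (∑ j, χ j * (P j).Λ ((3 / 4 : ℝ) : ℂ)) :=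
    HasMellin.finsetSum_const_mul fun j _ ↦
      (HurwitzZeta.isStrong_hurwitzOddFEPair (ZMod.toAddCircle j)).hasMellin _
  refine norm_LFunction_half_le_of_kernel (ν := 1) (σ := 3 / 4) (by norm_num) (by norm_num) hprim
    hχ0 (by rw [pow_one]; exact hodd) (K := HurwitzZeta.oddKernel) (C := HurwitzZeta.sinKernel) ?_ ?_ ?_
    hmel.1 ?_
  · intro a t ht
    simpa using HurwitzZeta.hasSum_int_oddKernel a ht
  · intro a t ht
    simpa using HurwitzZeta.hasSum_int_sinKernel a ht
  · intro a x
    rw [HurwitzZeta.oddKernel_functional_equation]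
    norm_num
  · have hod : (χ : ZMod N → ℂ).Odd := hodd.to_fun
    have hΛ : ∑ j, χ j * HurwitzZeta.completedHurwitzZetaOdd (ZMod.toAddCircle j) (1 / 2) =
        (∑ j, χ j * (P j).Λ ((3 / 4 : ℝ) : ℂ)) / 2 := by
      rw [Finset.sum_div]
      refine Finset.sum_congr rfl fun j _ ↦ ?_
      rw [HurwitzZeta.completedHurwitzZetaOdd, mul_div_assoc]
      norm_num [P]
    rw [LFunction, ZMod.LFunction_eq_completed_div_gammaFactor_odd hod,
      ZMod.completedLFunction_def_odd hod, hΛ, hmel.2]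
    congr 2
    push_cast
    norm_num

/-- A consequence of the approximate functional equation at the central point, covering both
parities. -/
lemma sq_norm_LFunction_half_le {N : ℕ} [NeZero N] (hN : 1 < N) {χ : DirichletCharacter ℂ N}
    (hprim : χ.IsPrimitive) :
    ‖LFunction χ (1 / 2)‖ ^ 2 ≤
      4 * ‖∑' n : ℕ, χ n * (afeWeight (1 / 4) N n / Real.sqrt n : ℝ)‖ ^ 2 +
        4 * ‖∑' n : ℕ, χ n * (afeWeight (3 / 4) N n / Real.sqrt n : ℝ)‖ ^ 2 := by
  have : Fact (1 < N) := ⟨hN⟩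
  have hχ0 : χ 0 = 0 := MulChar.map_zero χ
  have hχ : χ ≠ 1 := by
    rintro rfl
    rw [isPrimitive_def, conductor_one] at hprim
    omega
  have key {a b c : ℝ} (ha : 0 ≤ a) (h : a ≤ 2 * b) : a ^ 2 ≤ 4 * b ^ 2 + 4 * c ^ 2 := by
    nlinarith [pow_le_pow_left₀ ha h 2, sq_nonneg c]
  rcases χ.even_or_odd with h | h
  · exact key (norm_nonneg _) (norm_LFunction_half_le_of_even hprim hχ0 hχ h)
  · rw [add_comm]
    exact key (norm_nonneg _) (norm_LFunction_half_le_of_odd hprim hχ0 h)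

lemma conductor_mul_dvd_lcm {n : ℕ} [NeZero n] (χ₁ χ₂ : DirichletCharacter ℂ n) :
    (χ₁ * χ₂).conductor ∣ Nat.lcm χ₁.conductor χ₂.conductor := by
  have hl : Nat.lcm χ₁.conductor χ₂.conductor ∣ n :=
    Nat.lcm_dvd χ₁.conductor_dvd_level χ₂.conductor_dvd_level
  refine conductor_dvd_of_mem_conductorSet _ ⟨hl,
    χ₁.primitiveCharacter.mul χ₂.primitiveCharacter, ?_⟩
  rw [DirichletCharacter.mul, map_mul, ← changeLevel_trans, ← changeLevel_trans,
    changeLevel_primitiveCharacter, changeLevel_primitiveCharacter]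

lemma prodChar_isPrimitive {q D : ℕ} [NeZero q] [NeZero D] (hqD : q.Coprime D)
    {χ : DirichletCharacter ℂ q} {ψ : DirichletCharacter ℂ D} (hχ : χ.IsPrimitive)
    (hψ : ψ.IsPrimitive) : (prodChar χ ψ).IsPrimitive := by
  set χ' := changeLevel (dvd_mul_right q D) χ with hχ'
  set ψ' := changeLevel (dvd_mul_left D q) ψ with hψ'
  have hcχ : χ'.conductor = q := by rw [hχ', conductor_changeLevel]; exact hχ
  have hcψ : ψ'.conductor = D := by rw [hψ', conductor_changeLevel]; exact hψ
  have hP : prodChar χ ψ = χ' * ψ' := rfl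
  have h1 : q ∣ Nat.lcm (prodChar χ ψ).conductor D := by
    have := conductor_mul_dvd_lcm (prodChar χ ψ) ψ'⁻¹
    rwa [conductor_inv, hP, mul_inv_cancel_right, hcχ, hcψ, ← hP] at this
  have h2 : D ∣ Nat.lcm q (prodChar χ ψ).conductor := by
    have := conductor_mul_dvd_lcm χ'⁻¹ (prodChar χ ψ)
    rwa [conductor_inv, hP, inv_mul_cancel_left, hcχ, hcψ, ← hP] at this
  refine Nat.dvd_antisymm (conductor_dvd_level _) (hqD.mul_dvd_of_dvd_of_dvd ?_ ?_)
  · exact hqD.dvd_of_dvd_mul_right (h1.trans (Nat.lcm_dvd_mul _ _))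
  · exact hqD.symm.dvd_of_dvd_mul_left (h2.trans (Nat.lcm_dvd_mul _ _))

lemma isPrimitive_of_prime {q : ℕ} [NeZero q] (hq : q.Prime) {χ : DirichletCharacter ℂ q}
    (hχ : χ ≠ 1) : χ.IsPrimitive :=
  ((Nat.dvd_prime hq).mp χ.conductor_dvd_level).resolve_left
    (eq_one_iff_conductor_eq_one.not.mp hχ)

lemma prodChar_natCast {q D : ℕ} (χ : DirichletCharacter ℂ q) (ψ : DirichletCharacter ℂ D)
    (n : ℕ) : prodChar χ ψ n = χ n * ψ n := by
  by_cases h : n.Coprime (q * D)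
  · have h' : IsCoprime (n : ℤ) ((q * D : ℕ) : ℤ) := Nat.isCoprime_iff_coprime.mpr h
    have e1 := changeLevel_eq_cast_of_dvd' χ (dvd_mul_right q D) h'
    have e2 := changeLevel_eq_cast_of_dvd' ψ (dvd_mul_left D q) h'
    simp only [Int.cast_natCast] at e1 e2
    rw [prodChar, MulChar.mul_apply, e1, e2]
  · rw [MulChar.map_nonunit _ (by rwa [ZMod.isUnit_iff_coprime])]
    rw [Nat.coprime_mul_iff_right, not_and_or] at h
    rcases h with h | h
    · rw [MulChar.map_nonunit χ (by rwa [ZMod.isUnit_iff_coprime]), zero_mul]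
    · rw [MulChar.map_nonunit ψ (by rwa [ZMod.isUnit_iff_coprime]), mul_zero]

open scoped ComplexConjugate in
/-- Orthogonality of characters to a prime modulus, for coefficients supported on `[1, q - 1]`. -/
lemma sum_sq_norm_sum_mul_char_eq {q : ℕ} [NeZero q] (hq : q.Prime) {R : ℕ} (hR : R < q)
    (f : ℕ → ℂ) :
    ∑ χ : DirichletCharacter ℂ q, ‖∑ r ∈ Icc 1 R, f r * χ r‖ ^ 2 =
      q.totient * ∑ r ∈ Icc 1 R, ‖f r‖ ^ 2 := by
  have : Fact q.Prime := ⟨hq⟩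
  have hunit {r : ℕ} (hr : r ∈ Icc 1 R) : IsUnit (r : ZMod q) := by
    rw [mem_Icc] at hr
    rw [ZMod.isUnit_iff_coprime]
    exact (Nat.coprime_of_lt_prime (by omega) (by omega) hq).symm
  have hinj {r s : ℕ} (hr : r ∈ Icc 1 R) (hs : s ∈ Icc 1 R) :
      (r : ZMod q) = s ↔ r = s := by
    rw [mem_Icc] at hr hs
    rw [ZMod.natCast_eq_natCast_iff', Nat.mod_eq_of_lt (by omega), Nat.mod_eq_of_lt (by omega)]
  rw [← Complex.ofReal_inj]
  push_cast
  have hexp (χ : DirichletCharacter ℂ q) : ((‖∑ r ∈ Icc 1 R, f r * χ r‖ : ℝ) : ℂ) ^ 2 =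
      ∑ r ∈ Icc 1 R, ∑ s ∈ Icc 1 R, conj (f r) * f s * (χ (r : ZMod q)⁻¹ * χ s) := by
    rw [← Complex.conj_mul', map_sum, Finset.sum_mul_sum]
    refine Finset.sum_congr rfl fun r _ ↦ Finset.sum_congr rfl fun s _ ↦ ?_
    rw [map_mul, starRingEnd_apply (χ _), MulChar.star_apply', MulChar.inv_apply']
    ring
  simp_rw [hexp]
  rw [Finset.sum_comm, Finset.mul_sum]
  refine Finset.sum_congr rfl fun r hr ↦ ?_
  rw [Finset.sum_comm]
  simp_rw [← Finset.mul_sum, sum_char_inv_mul_char_eq ℂ (hunit hr)]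
  rw [Finset.sum_eq_single r, if_pos rfl, Complex.conj_mul', mul_comm]
  · intro s hs hsr
    rw [if_neg (fun h ↦ hsr ((hinj hr hs).mp h).symm), mul_zero]
  · exact fun h ↦ absurd hr h

/-- The sum of `g` over the divisors of `n`. -/
noncomputable def divisorSum (g : ℕ → ℝ) (n : ℕ) : ℝ := ∑ k ∈ n.divisors, g k

lemma divisorSum_nonneg {g : ℕ → ℝ} (hg : ∀ n, 0 ≤ g n) (n : ℕ) : 0 ≤ divisorSum g n :=
  Finset.sum_nonneg fun k _ ↦ hg k

lemma divisorSum_mul_le {g : ℕ → ℝ} (hg : ∀ n, 0 ≤ g n) (hmul : ∀ m n, g (m * n) ≤ g m * g n)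
    (m n : ℕ) : divisorSum g (m * n) ≤ divisorSum g m * divisorSum g n := by
  rw [divisorSum, Nat.divisors_mul, Finset.mul_def, divisorSum, divisorSum, Finset.sum_mul_sum,
    ← Finset.sum_product']
  exact (Finset.sum_image_le_of_nonneg fun _ _ ↦ hg _).trans
    (Finset.sum_le_sum fun _ _ ↦ hmul _ _)

lemma sum_sum_divisors_mul_le {u v : ℕ → ℝ} (hu : ∀ n, 0 ≤ u n) (hv : ∀ n, 0 ≤ v n) (x : ℕ) :
    ∑ n ∈ Icc 1 x, ∑ k ∈ n.divisors, u k * v (n / k) ≤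
      (∑ n ∈ Icc 1 x, u n) * ∑ n ∈ Icc 1 x, v n := by
  rw [Finset.sum_mul_sum, ← Finset.sum_product', Finset.sum_sigma']
  have hinj : Set.InjOn (fun p : (_ : ℕ) × ℕ ↦ (p.2, p.1 / p.2))
      ((Icc 1 x).sigma fun n ↦ n.divisors) := by
    rintro ⟨n, k⟩ hn ⟨m, l⟩ hm h
    simp only [Finset.coe_sigma, Set.mem_sigma_iff, Finset.mem_coe] at hn hm
    simp only [Prod.mk.injEq] at h
    obtain ⟨rfl, h⟩ := h
    rw [(Nat.div_left_inj (Nat.dvd_of_mem_divisors hn.2) (Nat.dvd_of_mem_divisors hm.2)).mp h]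
  rw [← Finset.sum_image (f := fun p : ℕ × ℕ ↦ u p.1 * v p.2) hinj]
  refine Finset.sum_le_sum_of_subset_of_nonneg ?_ fun p _ _ ↦ mul_nonneg (hu _) (hv _)
  rintro _ hp
  obtain ⟨⟨n, k⟩, hnk, rfl⟩ := Finset.mem_image.mp hp
  simp only [mem_sigma, mem_Icc, Nat.mem_divisors, mem_product] at hnk ⊢
  obtain ⟨⟨hn1, hnx⟩, hk, hn0⟩ := hnk
  have hk0 := Nat.pos_of_dvd_of_pos hk hn1
  have hkn := Nat.le_of_dvd hn1 hk
  exact ⟨⟨hk0, hkn.trans hnx⟩, Nat.div_pos hkn hk0, (Nat.div_le_self n k).trans hnx⟩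

lemma sum_divisorSum_mul_div_le {g w : ℕ → ℝ} (hg : ∀ n, 0 ≤ g n) (hw : ∀ n, 0 ≤ w n)
    (hmul : ∀ m n, w (m * n) ≤ w m * w n) (x : ℕ) :
    ∑ n ∈ Icc 1 x, divisorSum g n * w n / n ≤
      (∑ n ∈ Icc 1 x, g n * w n / n) * ∑ n ∈ Icc 1 x, w n / n := by
  refine le_trans (Finset.sum_le_sum fun n hn ↦ ?_)
    (sum_sum_divisors_mul_le (u := fun n ↦ g n * w n / n) (v := fun n ↦ w n / n)
      (fun n ↦ div_nonneg (mul_nonneg (hg n) (hw n)) n.cast_nonneg)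
      (fun n ↦ div_nonneg (hw n) n.cast_nonneg) x)
  rw [divisorSum, Finset.sum_mul, Finset.sum_div]
  refine Finset.sum_le_sum fun k hk ↦ ?_
  obtain ⟨l, rfl⟩ := Nat.dvd_of_mem_divisors hk
  have hk0 : 0 < k := Nat.pos_of_mem_divisors hk
  rw [Nat.mul_div_cancel_left l hk0, div_mul_div_comm, Nat.cast_mul, mul_assoc]
  gcongr
  · exact hg k
  · exact hmul k l

/-- The three-fold divisor function. -/
noncomputable def divisorThree : ℕ → ℝ := divisorSum (divisorSum fun _ ↦ 1)

lemma divisorThree_nonneg (n : ℕ) : 0 ≤ divisorThree n :=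
  divisorSum_nonneg (divisorSum_nonneg fun _ ↦ zero_le_one) n

lemma sum_divisorThree_mul_div_le {w : ℕ → ℝ} (hw : ∀ n, 0 ≤ w n)
    (hmul : ∀ m n, w (m * n) ≤ w m * w n) (x : ℕ) :
    ∑ n ∈ Icc 1 x, divisorThree n * w n / n ≤ (∑ n ∈ Icc 1 x, w n / n) ^ 3 := by
  have h0 : 0 ≤ ∑ n ∈ Icc 1 x, w n / n :=
    Finset.sum_nonneg fun n _ ↦ div_nonneg (hw n) n.cast_nonneg
  have h1 := sum_divisorSum_mul_div_le (g := fun _ ↦ 1) (fun _ ↦ zero_le_one) hw hmul x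
  simp only [one_mul] at h1
  refine (sum_divisorSum_mul_div_le (divisorSum_nonneg fun _ ↦ zero_le_one) hw hmul x).trans ?_
  rw [pow_succ, sq]
  gcongr

lemma sum_sq_divisorThree_div_le {x y : ℕ} (hxy : x ≤ y) :
    ∑ n ∈ Icc 1 x, divisorThree n ^ 2 / n ≤ (1 + Real.log y) ^ 9 := by
  have hd : ∀ m n, divisorThree (m * n) ≤ divisorThree m * divisorThree n :=
    divisorSum_mul_le (divisorSum_nonneg fun _ ↦ zero_le_one)
      (divisorSum_mul_le (fun _ ↦ zero_le_one) fun _ _ ↦ by simp)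
  have hH : ∑ n ∈ Icc 1 x, (1 : ℝ) / n ≤ 1 + Real.log y := by
    refine le_trans (Finset.sum_le_sum_of_subset_of_nonneg (Icc_subset_Icc_right hxy)
      fun _ _ _ ↦ by positivity) ?_
    have := harmonic_le_one_add_log y
    rw [harmonic_eq_sum_Icc] at this
    push_cast at this
    simpa using this
  have h1 := sum_divisorThree_mul_div_le divisorThree_nonneg hd x
  have h2 := sum_divisorThree_mul_div_le (w := fun _ ↦ 1) (fun _ ↦ zero_le_one)
    (fun _ _ ↦ by simp) x
  simp only [mul_one] at h2
  have h0 : 0 ≤ ∑ n ∈ Icc 1 x, divisorThree n / n :=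
    Finset.sum_nonneg fun n _ ↦ div_nonneg (divisorThree_nonneg n) n.cast_nonneg
  have h00 : 0 ≤ ∑ n ∈ Icc 1 x, (1 : ℝ) / n := Finset.sum_nonneg fun n _ ↦ by positivity
  calc ∑ n ∈ Icc 1 x, divisorThree n ^ 2 / n ≤ (∑ n ∈ Icc 1 x, divisorThree n / n) ^ 3 := by
        simpa only [sq] using h1
    _ ≤ ((∑ n ∈ Icc 1 x, (1 : ℝ) / n) ^ 3) ^ 3 := by gcongr
    _ = (∑ n ∈ Icc 1 x, (1 : ℝ) / n) ^ 9 := by ring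
    _ ≤ (1 + Real.log y) ^ 9 := by gcongr

lemma norm_sum_fiber_mul_le {a b : ℕ → ℂ} (ha : ∀ m, ‖a m‖ ≤ 2 / Real.sqrt m)
    (hb : ∀ k, ‖b k‖ ≤ divisorSum (fun _ ↦ 1) k / Real.sqrt k) (Y X : ℕ) {r : ℕ} (hr : r ≠ 0) :
    ‖∑ p ∈ Icc 1 Y ×ˢ Icc 1 X with p.1 * p.2 = r, a p.1 * b p.2‖ ≤
      2 * divisorThree r / Real.sqrt r := by
  calc ‖∑ p ∈ Icc 1 Y ×ˢ Icc 1 X with p.1 * p.2 = r, a p.1 * b p.2‖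
      ≤ ∑ p ∈ Icc 1 Y ×ˢ Icc 1 X with p.1 * p.2 = r, ‖a p.1‖ * ‖b p.2‖ :=
        (norm_sum_le _ _).trans_eq (Finset.sum_congr rfl fun _ _ ↦ norm_mul _ _)
    _ ≤ ∑ p ∈ r.divisorsAntidiagonal, ‖a p.1‖ * ‖b p.2‖ := by
        refine Finset.sum_le_sum_of_subset_of_nonneg (fun p hp ↦ ?_) fun _ _ _ ↦ by positivity
        rw [Nat.mem_divisorsAntidiagonal]
        exact ⟨(mem_filter.mp hp).2, hr⟩
    _ ≤ ∑ p ∈ r.divisorsAntidiagonal, 2 / Real.sqrt r * divisorSum (fun _ ↦ 1) p.2 := by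
        refine Finset.sum_le_sum fun p hp ↦ ?_
        rw [← (Nat.mem_divisorsAntidiagonal.mp hp).1, Nat.cast_mul, Real.sqrt_mul p.1.cast_nonneg]
        calc ‖a p.1‖ * ‖b p.2‖
            ≤ 2 / Real.sqrt p.1 * (divisorSum (fun _ ↦ 1) p.2 / Real.sqrt p.2) := by
              gcongr
              exacts [ha _, hb _]
          _ = _ := by ring
    _ = 2 * divisorThree r / Real.sqrt r := by
        rw [← Finset.mul_sum, Nat.sum_divisorsAntidiagonal (fun _ k ↦ divisorSum (fun _ ↦ 1) k),
          Nat.sum_div_divisors, divisorThree, divisorSum]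
        ring

lemma sum_sq_norm_mul_le {q : ℕ} [NeZero q] (hq : q.Prime) {Y X : ℕ} (hYX : Y * X < q)
    {a b : ℕ → ℂ} (ha : ∀ m, ‖a m‖ ≤ 2 / Real.sqrt m)
    (hb : ∀ k, ‖b k‖ ≤ divisorSum (fun _ ↦ 1) k / Real.sqrt k) :
    ∑ χ : DirichletCharacter ℂ q,
      ‖(∑ m ∈ Icc 1 Y, a m * χ m) * ∑ k ∈ Icc 1 X, b k * χ k‖ ^ 2 ≤
      q.totient * (4 * (1 + Real.log q) ^ 9) := by
  have hprod (χ : DirichletCharacter ℂ q) :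
      (∑ m ∈ Icc 1 Y, a m * χ m) * ∑ k ∈ Icc 1 X, b k * χ k =
        ∑ r ∈ Icc 1 (Y * X), (∑ p ∈ Icc 1 Y ×ˢ Icc 1 X with p.1 * p.2 = r, a p.1 * b p.2) * χ r := by
    rw [Finset.sum_mul_sum, ← Finset.sum_product',
      ← Finset.sum_fiberwise_of_maps_to (t := Icc 1 (Y * X)) (g := fun p ↦ p.1 * p.2)]
    · refine Finset.sum_congr rfl fun r _ ↦ ?_
      rw [Finset.sum_mul]
      refine Finset.sum_congr rfl fun p hp ↦ ?_
      rw [← (mem_filter.mp hp).2, Nat.cast_mul, map_mul]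
      ring
    · intro p hp
      simp only [mem_product, mem_Icc] at hp ⊢
      exact ⟨Nat.mul_pos hp.1.1 hp.2.1, Nat.mul_le_mul hp.1.2 hp.2.2⟩
  simp_rw [hprod]
  rw [sum_sq_norm_sum_mul_char_eq hq hYX]
  gcongr
  refine le_trans ?_ (mul_le_mul_of_nonneg_left (sum_sq_divisorThree_div_le hYX.le) zero_le_four)
  rw [Finset.mul_sum]
  refine Finset.sum_le_sum fun r hr ↦ ?_
  have hr0 : r ≠ 0 := by rw [mem_Icc] at hr; omega
  refine (pow_le_pow_left₀ (norm_nonneg _) (norm_sum_fiber_mul_le ha hb Y X hr0) 2).trans_eq ?_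
  rw [div_pow, Real.sq_sqrt r.cast_nonneg]
  ring

lemma norm_mollifierCoeff_le {D : ℕ} (ψ : DirichletCharacter ℂ D) (n : ℕ) :
    ‖mollifierCoeff ψ n‖ ≤ divisorSum (fun _ ↦ 1) n := by
  refine (norm_sum_le _ _).trans (Finset.sum_le_sum fun d _ ↦ ?_)
  have hμ (k : ℕ) : ‖((ArithmeticFunction.moebius k : ℤ) : ℂ)‖ ≤ 1 := by
    rw [Complex.norm_intCast]
    exact_mod_cast ArithmeticFunction.abs_moebius_le_one
  rw [norm_mul, norm_mul]
  exact mul_le_one₀ (mul_le_one₀ (hμ _) (norm_nonneg _) (hμ _)) (norm_nonneg _) (ψ.norm_le_one _)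

/-- The coefficient of `χ n` in the mollifier. -/
noncomputable def mollifierWeight {D : ℕ} (ψ : DirichletCharacter ℂ D) (n : ℕ) : ℂ :=
  if D ∣ n then 0 else mollifierCoeff ψ n / (Real.sqrt n : ℂ)

lemma mollifier_eq_sum_mollifierWeight {q D : ℕ} (ψ : DirichletCharacter ℂ D) (X : ℕ)
    (χ : DirichletCharacter ℂ q) :
    mollifier ψ X χ = ∑ n ∈ Icc 1 X, mollifierWeight ψ n * χ n := by
  refine Finset.sum_congr rfl fun n _ ↦ ?_
  rw [mollifierWeight]
  split_ifs <;> ring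

lemma norm_mollifierWeight_le {D : ℕ} (ψ : DirichletCharacter ℂ D) (n : ℕ) :
    ‖mollifierWeight ψ n‖ ≤ divisorSum (fun _ ↦ 1) n / Real.sqrt n := by
  rw [mollifierWeight]
  split_ifs
  · rw [norm_zero]
    exact div_nonneg (divisorSum_nonneg (fun _ ↦ zero_le_one) n) (Real.sqrt_nonneg _)
  · rw [norm_div, Complex.norm_real, Real.norm_of_nonneg (Real.sqrt_nonneg _)]
    gcongr
    exact norm_mollifierCoeff_le ψ n

lemma norm_mollifier_le {q D : ℕ} (ψ : DirichletCharacter ℂ D) (X : ℕ)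
    (χ : DirichletCharacter ℂ q) : ‖mollifier ψ X χ‖ ≤ (X : ℝ) ^ 2 := by
  rw [mollifier_eq_sum_mollifierWeight]
  calc _ ≤ ∑ n ∈ Icc 1 X, (X : ℝ) := by
        refine (norm_sum_le _ _).trans (Finset.sum_le_sum fun n hn ↦ ?_)
        rw [mem_Icc] at hn
        have h1 : (1 : ℝ) ≤ Real.sqrt n := by
          rw [Real.one_le_sqrt]; exact_mod_cast hn.1
        have h2 : divisorSum (fun _ ↦ 1) n ≤ X := by
          simp only [divisorSum, Finset.sum_const, nsmul_eq_mul, mul_one]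
          exact_mod_cast (Nat.card_divisors_le_self n).trans hn.2
        calc ‖mollifierWeight ψ n * χ n‖ ≤ ‖mollifierWeight ψ n‖ * 1 := by
              rw [norm_mul]; gcongr; exact χ.norm_le_one _
          _ ≤ divisorSum (fun _ ↦ 1) n / Real.sqrt n := by
              rw [mul_one]; exact norm_mollifierWeight_le ψ n
          _ ≤ divisorSum (fun _ ↦ 1) n :=
              div_le_self (divisorSum_nonneg (fun _ ↦ zero_le_one) n) h1
          _ ≤ X := h2
    _ = (X : ℝ) ^ 2 := by simp [sq]

lemma exp_neg_le_factorial_div_pow {y : ℝ} (hy : 0 < y) (k : ℕ) :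
    Real.exp (-y) ≤ k.factorial / y ^ k := by
  rw [Real.exp_neg, ← inv_div]
  exact inv_anti₀ (by positivity) (Real.pow_div_factorial_le_exp y hy.le k)

lemma afeWeight_div_sqrt_le {σ : ℝ} (hσ : 0 < σ) (hσ1 : σ ≤ 1) (N : ℕ) [NeZero N] (k n : ℕ) :
    afeWeight σ N n / Real.sqrt n ≤ 2 * k.factorial * (N : ℝ) ^ k / n ^ (2 * k) := by
  rcases Nat.eq_zero_or_pos n with rfl | hn
  · simp only [Nat.cast_zero, Real.sqrt_zero, div_zero]
    positivity
  have hN : (0 : ℝ) < N := by exact_mod_cast NeZero.pos N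
  have hn0 : (0 : ℝ) < n := by exact_mod_cast hn
  have hs : 1 ≤ Real.sqrt n := by rw [Real.one_le_sqrt]; exact_mod_cast hn
  have hy : (n : ℝ) ^ 2 / N ≤ Real.pi * n ^ 2 / N / 2 := by
    rw [mul_div_assoc, mul_comm, mul_div_assoc]
    exact le_mul_of_one_le_right (by positivity) (by linarith [Real.pi_gt_three])
  calc afeWeight σ N n / Real.sqrt n ≤ afeWeight σ N n := div_le_self (afeWeight_nonneg hσ N n) hs
    _ ≤ 2 * Real.exp (-(Real.pi * n ^ 2 / N / 2)) := afeWeight_le hσ hσ1 N n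
    _ ≤ 2 * Real.exp (-((n : ℝ) ^ 2 / N)) := by gcongr
    _ ≤ 2 * (k.factorial / ((n : ℝ) ^ 2 / N) ^ k) := by
        gcongr; exact exp_neg_le_factorial_div_pow (by positivity) k
    _ = 2 * k.factorial * (N : ℝ) ^ k / n ^ (2 * k) := by
        rw [div_pow, ← pow_mul]; field_simp

lemma norm_tsum_afeWeight_sub_sum_le {σ : ℝ} (hσ : 0 < σ) (hσ1 : σ ≤ 1) {q D : ℕ} [NeZero q]
    [NeZero D] {Y : ℕ} (hY : q ≤ (Y + 1) * D ^ 20) {c : ℕ → ℂ} (hc : ∀ n, ‖c n‖ ≤ 1) :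
    ‖∑' n : ℕ, c n * (afeWeight σ (q * D) n / Real.sqrt n : ℝ) -
      ∑ n ∈ Icc 1 Y, c n * (afeWeight σ (q * D) n / Real.sqrt n : ℝ)‖ ≤
      96 * (D : ℝ) ^ 124 / q ^ 2 := by
  have hq : (0 : ℝ) < q := by exact_mod_cast NeZero.pos q
  have hD : (0 : ℝ) < D := by exact_mod_cast NeZero.pos D
  set f : ℕ → ℂ := fun n ↦ c n * (afeWeight σ (q * D) n / Real.sqrt n : ℝ) with hf
  have hnorm (n : ℕ) : ‖f n‖ ≤ afeWeight σ (q * D) n / Real.sqrt n := by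
    rw [hf, norm_mul, Complex.norm_real,
      Real.norm_of_nonneg (div_nonneg (afeWeight_nonneg hσ _ n) (Real.sqrt_nonneg _))]
    exact mul_le_of_le_one_left (div_nonneg (afeWeight_nonneg hσ _ n) (Real.sqrt_nonneg _)) (hc n)
  have hsum : Summable f := by
    refine Summable.of_norm_bounded (g := fun n : ℕ ↦ 2 * ((q * D : ℕ) : ℝ) * (1 / (n : ℝ) ^ 2))
      (hasSum_zeta_two.summable.mul_left _) fun n ↦ (hnorm n).trans ?_
    refine (afeWeight_div_sqrt_le hσ hσ1 (q * D) 1 n).trans_eq ?_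
    simp
    ring
  have hfin : ∑ n ∈ Icc 1 Y, f n = ∑' n, if n ∈ Icc 1 Y then f n else 0 := by
    rw [tsum_eq_sum (s := Icc 1 Y) fun n hn ↦ if_neg hn]
    exact Finset.sum_congr rfl fun n hn ↦ (if_pos hn).symm
  have hsum' : Summable fun n ↦ if n ∈ Icc 1 Y then f n else 0 :=
    summable_of_ne_finset_zero (s := Icc 1 Y) fun n hn ↦ if_neg hn
  rw [hfin, ← hsum.tsum_sub hsum']
  refine (tsum_of_norm_bounded (hasSum_zeta_two.mul_left (48 * (D : ℝ) ^ 124 / q ^ 2))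
    fun n ↦ ?_).trans ?_
  · split_ifs with hn
    · rw [sub_self, norm_zero]; positivity
    · rw [sub_zero]
      rcases Nat.eq_zero_or_pos n with rfl | hn0
      · simp [hf]
      have hnY : Y + 1 ≤ n := by
        rw [mem_Icc] at hn; omega
      have hn1 : (0 : ℝ) < n := by exact_mod_cast hn0
      have hqn : (q : ℝ) ≤ n * D ^ 20 := by
        exact_mod_cast hY.trans (Nat.mul_le_mul_right _ hnY)
      refine (hnorm n).trans ((afeWeight_div_sqrt_le hσ hσ1 (q * D) 4 n).trans ?_)
      rw [mul_one_div, div_div, div_le_div_iff₀ (by positivity) (by positivity)]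
      have h6 : (q : ℝ) ^ 6 ≤ (n * D ^ 20) ^ 6 := by gcongr
      have h24 : ((Nat.factorial 4 : ℕ) : ℝ) = 24 := by norm_num [Nat.factorial]
      rw [h24]
      push_cast
      calc 2 * 24 * ((q : ℝ) * D) ^ 4 * ((q : ℝ) ^ 2 * (n : ℝ) ^ 2)
          = 48 * (D : ℝ) ^ 4 * (n : ℝ) ^ 2 * (q : ℝ) ^ 6 := by ring
        _ ≤ 48 * (D : ℝ) ^ 4 * (n : ℝ) ^ 2 * (n * (D : ℝ) ^ 20) ^ 6 := by gcongr
        _ = _ := by ring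
  · have hpi : Real.pi ^ 2 / 6 ≤ 2 := by nlinarith [Real.pi_lt_d2, Real.pi_pos]
    calc _ ≤ 48 * (D : ℝ) ^ 124 / q ^ 2 * 2 := by gcongr
      _ = _ := by ring

/-- The partial sum of length `Y` of the series approximating `L(1/2, χψ)`. -/
noncomputable def afePartialSum {q D : ℕ} (σ : ℝ) (Y : ℕ) (ψ : DirichletCharacter ℂ D)
    (χ : DirichletCharacter ℂ q) : ℂ :=
  ∑ n ∈ Icc 1 Y, ψ n * (afeWeight σ (q * D) n / Real.sqrt n : ℝ) * χ n

lemma norm_tsum_mul_mollifier_sq_le {σ : ℝ} (hσ : 0 < σ) (hσ1 : σ ≤ 1) {q D : ℕ} [NeZero q]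
    [NeZero D] (hqD : (D : ℝ) ^ 300 ≤ q) {Y : ℕ} (hY : q ≤ (Y + 1) * D ^ 20)
    (ψ : DirichletCharacter ℂ D) (χ : DirichletCharacter ℂ q) :
    (‖∑' n : ℕ, prodChar χ ψ n * (afeWeight σ (q * D) n / Real.sqrt n : ℝ)‖ *
      ‖mollifier ψ (D ^ 20) χ‖) ^ 2 ≤
      2 * ‖afePartialSum σ Y ψ χ * mollifier ψ (D ^ 20) χ‖ ^ 2 + 2 * 96 ^ 2 := by
  have hD : (1 : ℝ) ≤ D := by exact_mod_cast NeZero.pos D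
  have hB : ∑ n ∈ Icc 1 Y, prodChar χ ψ n * (afeWeight σ (q * D) n / Real.sqrt n : ℝ) =
      afePartialSum σ Y ψ χ := by
    refine Finset.sum_congr rfl fun n _ ↦ ?_
    rw [prodChar_natCast]
    ring
  have htail := norm_tsum_afeWeight_sub_sum_le hσ hσ1 hY (c := fun n ↦ prodChar χ ψ n)
    fun n ↦ (prodChar χ ψ).norm_le_one _
  rw [hB] at htail
  set S := ∑' n : ℕ, prodChar χ ψ n * (afeWeight σ (q * D) n / Real.sqrt n : ℝ)
  set B := afePartialSum σ Y ψ χ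
  have hM := norm_mollifier_le ψ (D ^ 20) χ
  set M := mollifier ψ (D ^ 20) χ
  have hTM : ‖S - B‖ * ‖M‖ ≤ 96 := by
    calc ‖S - B‖ * ‖M‖ ≤ 96 * (D : ℝ) ^ 124 / q ^ 2 * ((D ^ 20 : ℕ) : ℝ) ^ 2 := by gcongr
      _ ≤ 96 * (D : ℝ) ^ 124 / ((D : ℝ) ^ 300) ^ 2 * ((D ^ 20 : ℕ) : ℝ) ^ 2 := by gcongr
      _ = 96 / (D : ℝ) ^ 436 := by
          push_cast
          field_simp
      _ ≤ 96 := div_le_self (by norm_num) (one_le_pow₀ hD)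
  have hSB : ‖S‖ * ‖M‖ ≤ ‖B * M‖ + 96 := by
    calc ‖S‖ * ‖M‖ ≤ (‖B‖ + ‖S - B‖) * ‖M‖ := by
          gcongr
          simpa using norm_add_le B (S - B)
      _ = ‖B * M‖ + ‖S - B‖ * ‖M‖ := by rw [norm_mul]; ring
      _ ≤ ‖B * M‖ + 96 := by gcongr
  calc (‖S‖ * ‖M‖) ^ 2 ≤ (‖B * M‖ + 96) ^ 2 := by gcongr
    _ ≤ _ := by nlinarith [sq_nonneg (‖B * M‖ - 96)]

lemma sum_sq_norm_afePartialSum_mul_mollifier_le {σ : ℝ} (hσ : 0 < σ) (hσ1 : σ ≤ 1) {q D : ℕ}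
    [NeZero q] [NeZero D] (hq : q.Prime) {Y X : ℕ} (hYX : Y * X < q)
    (ψ : DirichletCharacter ℂ D) :
    ∑ χ : DirichletCharacter ℂ q, ‖afePartialSum σ Y ψ χ * mollifier ψ X χ‖ ^ 2 ≤
      q.totient * (4 * (1 + Real.log q) ^ 9) := by
  simp_rw [mollifier_eq_sum_mollifierWeight, afePartialSum]
  refine sum_sq_norm_mul_le hq hYX
    (a := fun n ↦ ψ n * (afeWeight σ (q * D) n / Real.sqrt n : ℝ)) (fun n ↦ ?_)
    (norm_mollifierWeight_le ψ)
  have h0 := afeWeight_nonneg hσ (q * D) n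
  rw [norm_mul, Complex.norm_real, Real.norm_of_nonneg (div_nonneg h0 (Real.sqrt_nonneg _))]
  refine (mul_le_of_le_one_left (div_nonneg h0 (Real.sqrt_nonneg _)) (ψ.norm_le_one _)).trans ?_
  gcongr
  refine (afeWeight_le hσ hσ1 (q * D) n).trans (mul_le_of_le_one_right zero_le_two ?_)
  rw [Real.exp_le_one_iff, neg_nonpos]
  positivity

/-- The second moment of the mollified central values over non-principal characters. -/
lemma sum_sq_norm_LFunction_mul_mollifier_le {q D : ℕ} [NeZero q] [NeZero D] (hD : 1 < D)
    {ψ : DirichletCharacter ℂ D} (hψ : ψ.IsPrimitive) (hq : q.Prime) (hqD : (D : ℝ) ^ 300 ≤ q) :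
    ∑ χ : DirichletCharacter ℂ q with χ ≠ 1,
      ‖LFunction (prodChar χ ψ) (1 / 2) * mollifier ψ (D ^ 20) χ‖ ^ 2 ≤
      180224 * q.totient * Real.log q ^ 9 := by
  have hqD' : D ^ 300 ≤ q := by exact_mod_cast hqD
  have hDq : D < q := lt_of_lt_of_le (lt_self_pow₀ hD (by norm_num)) hqD'
  have hcop : q.Coprime D := Nat.coprime_of_lt_prime (NeZero.ne D) hDq hq
  have hlog : 1 ≤ Real.log q := by
    rw [Real.le_log_iff_exp_le (by exact_mod_cast hq.pos)]
    have h2 : (2 : ℝ) ^ 2 ≤ (D : ℝ) ^ 300 :=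
      calc (2 : ℝ) ^ 2 ≤ 2 ^ 300 := pow_le_pow_right₀ one_le_two (by norm_num)
        _ ≤ (D : ℝ) ^ 300 := by gcongr; exact_mod_cast hD
    linarith [Real.exp_one_lt_d9]
  set Y := (q - 1) / D ^ 20 with hYdef
  have hDpos : 0 < D ^ 20 := by positivity
  have hq1 := hq.pos
  have hYX : Y * D ^ 20 < q := by
    have := Nat.div_mul_le_self (q - 1) (D ^ 20)
    rw [← hYdef] at this
    omega
  have hY : q ≤ (Y + 1) * D ^ 20 := by
    have := (Nat.div_lt_iff_lt_mul hDpos).mp (Nat.lt_succ_self ((q - 1) / D ^ 20))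
    rw [Nat.succ_eq_add_one, ← hYdef] at this
    omega
  have hpoint {χ : DirichletCharacter ℂ q} (hχ : χ ≠ 1) :
      ‖LFunction (prodChar χ ψ) (1 / 2) * mollifier ψ (D ^ 20) χ‖ ^ 2 ≤
        8 * ‖afePartialSum (1 / 4) Y ψ χ * mollifier ψ (D ^ 20) χ‖ ^ 2 +
          8 * ‖afePartialSum (3 / 4) Y ψ χ * mollifier ψ (D ^ 20) χ‖ ^ 2 + 16 * 96 ^ 2 := by
    have hL := sq_norm_LFunction_half_le (hD.trans_le (Nat.le_mul_of_pos_left D hq1))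
      (prodChar_isPrimitive hcop (isPrimitive_of_prime hq hχ) hψ)
    have h1 := norm_tsum_mul_mollifier_sq_le (σ := 1 / 4) (by norm_num) (by norm_num) hqD hY ψ χ
    have h2 := norm_tsum_mul_mollifier_sq_le (σ := 3 / 4) (by norm_num) (by norm_num) hqD hY ψ χ
    have hLM := mul_le_mul_of_nonneg_right hL (sq_nonneg ‖mollifier ψ (D ^ 20) χ‖)
    rw [mul_pow] at h1 h2
    rw [norm_mul, mul_pow]
    linarith
  have hcard : (Fintype.card (DirichletCharacter ℂ q) : ℝ) = q.totient := by
    rw [← Nat.card_eq_fintype_card, card_eq_totient_of_hasEnoughRootsOfUnity]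
  have hs1 := sum_sq_norm_afePartialSum_mul_mollifier_le (σ := 1 / 4) (by norm_num) (by norm_num)
    hq hYX ψ
  have hs2 := sum_sq_norm_afePartialSum_mul_mollifier_le (σ := 3 / 4) (by norm_num) (by norm_num)
    hq hYX ψ
  calc _ ≤ ∑ χ : DirichletCharacter ℂ q with χ ≠ 1,
        (8 * ‖afePartialSum (1 / 4) Y ψ χ * mollifier ψ (D ^ 20) χ‖ ^ 2 +
          8 * ‖afePartialSum (3 / 4) Y ψ χ * mollifier ψ (D ^ 20) χ‖ ^ 2 + 16 * 96 ^ 2) :=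
        Finset.sum_le_sum fun χ hχ ↦ hpoint (mem_filter.mp hχ).2
    _ ≤ ∑ χ : DirichletCharacter ℂ q,
        (8 * ‖afePartialSum (1 / 4) Y ψ χ * mollifier ψ (D ^ 20) χ‖ ^ 2 +
          8 * ‖afePartialSum (3 / 4) Y ψ χ * mollifier ψ (D ^ 20) χ‖ ^ 2 + 16 * 96 ^ 2) :=
        Finset.sum_le_sum_of_subset_of_nonneg (filter_subset _ _) fun _ _ _ ↦ by positivity
    _ ≤ q.totient * (64 * (1 + Real.log q) ^ 9 + 16 * 96 ^ 2) := by
        rw [Finset.sum_add_distrib, Finset.sum_add_distrib, ← Finset.mul_sum, ← Finset.mul_sum,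
          Finset.sum_const, Finset.card_univ, nsmul_eq_mul, hcard]
        linarith
    _ ≤ q.totient * (64 * (2 * Real.log q) ^ 9 + 16 * 96 ^ 2 * Real.log q ^ 9) := by
        have h9 : 1 ≤ Real.log q ^ 9 := one_le_pow₀ hlog
        have h2 : (1 + Real.log q) ^ 9 ≤ (2 * Real.log q) ^ 9 :=
          pow_le_pow_left₀ (by linarith) (by linarith) 9
        exact mul_le_mul_of_nonneg_left (by linarith) (Nat.cast_nonneg _)
    _ = 180224 * q.totient * Real.log q ^ 9 := by ring

/-- for `δ ∈ (0,1]`, the number of non-principal characters `χ` mod `q` with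
`|L(1/2, χψ) M(χ)| ≥ δ^{-1/2} (log q)^{9/2}` is `O(δ φ(q))`, the implied constant depending
only on `C`. -/
theorem card_large_mollified_L (C : ℝ) (hC : 300 < C) :
    ∃ c : ℝ, 0 < c ∧
      ∀ (D : ℕ) [NeZero D], 1 < D → Squarefree D → D % 4 = 1 →
      ∀ ψ : DirichletCharacter ℂ D, ψ.IsPrimitive → ψ ^ 2 = 1 → ψ ≠ 1 →
      ∀ (q : ℕ) [NeZero q], q.Prime → ((D : ℝ) ^ (300 : ℕ) ≤ q) → ((q : ℝ) ≤ (D : ℝ) ^ C) →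
      ∀ δ : ℝ, 0 < δ → δ ≤ 1 →
      (Nat.card {χ : DirichletCharacter ℂ q // χ ≠ 1 ∧
          δ ^ (-(1 : ℝ) / 2) * Real.log q ^ ((9 : ℝ) / 2) ≤
            ‖LFunction (prodChar χ ψ) (1 / 2) * mollifier ψ (D ^ 20) χ‖} : ℝ) ≤
        c * δ * (Nat.totient q) := by
  refine ⟨180224, by norm_num, fun D _ hD _ _ ψ hψ _ _ q _ hq hqD _ δ hδ _ ↦ ?_⟩
  have hmoment := sum_sq_norm_LFunction_mul_mollifier_le hD hψ hq hqD
  have hlog : 0 < Real.log q := Real.log_pos (by exact_mod_cast hq.one_lt)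
  set F : DirichletCharacter ℂ q → ℝ :=
    fun χ ↦ ‖LFunction (prodChar χ ψ) (1 / 2) * mollifier ψ (D ^ 20) χ‖
  set T := δ ^ (-(1 : ℝ) / 2) * Real.log q ^ ((9 : ℝ) / 2) with hT
  have hT0 : 0 ≤ T := by positivity
  have hTsq : T ^ 2 = δ⁻¹ * Real.log q ^ 9 := by
    rw [hT, mul_pow, ← Real.rpow_natCast, ← Real.rpow_natCast, ← Real.rpow_mul hδ.le,
      ← Real.rpow_mul hlog.le, ← Real.rpow_neg_one, ← Real.rpow_natCast]
    norm_num
  classical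
  rw [Nat.card_eq_fintype_card, Fintype.card_subtype]
  have hcheb : #{χ : DirichletCharacter ℂ q | χ ≠ 1 ∧ T ≤ F χ} * T ^ 2 ≤
      180224 * q.totient * Real.log q ^ 9 := by
    rw [← nsmul_eq_mul, ← Finset.sum_const]
    calc _ ≤ ∑ χ : DirichletCharacter ℂ q with χ ≠ 1 ∧ T ≤ F χ, F χ ^ 2 :=
          Finset.sum_le_sum fun χ hχ ↦ pow_le_pow_left₀ hT0 (mem_filter.mp hχ).2.2 2
      _ ≤ ∑ χ : DirichletCharacter ℂ q with χ ≠ 1, F χ ^ 2 :=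
          Finset.sum_le_sum_of_subset_of_nonneg
            (Finset.monotone_filter_right _ fun _ _ h ↦ h.1) fun _ _ _ ↦ sq_nonneg _
      _ ≤ _ := hmoment
  rw [hTsq, ← mul_assoc] at hcheb
  have h := le_of_mul_le_mul_right hcheb (by positivity)
  rw [← div_eq_mul_inv, div_le_iff₀ hδ] at h
  linarith
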